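/- Let Λ > 0, let h₀ ∈ C⁰([0,∞)) and let h : [0,∞)×[0,∞) → ℝ be continuous. If ‖h₀‖_{C⁰} ≤ y₀ and ‖h‖_{C⁰} ≤ y₀ for some y₀ ≥ 0 (i.e. sup|h₀| ≤ y₀ and sup|h| ≤ y₀), then ‖F(h)‖_{C⁰} ≤ y₀, i.e. |F(h)(u₁,r₁)| ≤ y₀ for all (u₁,r₁) ∈ [0,∞)×[0,∞). -/

import Mathlib

open Real Set

/-- The spherical mean `h̄(u,r) = (1/r) ∫₀^r h(u,s) ds`, with `h̄(u,0) = h(u,0)`. -/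
noncomputable def hbar (h : ℝ → ℝ → ℝ) (u r : ℝ) : ℝ :=
  if r = 0 then h u 0 else (∫ s in (0:ℝ)..r, h u s) / r

/-- `χ` is the characteristic through `(u₁,r₁)`: it solves
`χ' = -(1/2)(1 - (Λ/3) χ²)` on `[0,u₁]` with `χ(u₁) = r₁`. -/
def IsChar (Λ u₁ r₁ : ℝ) (χ : ℝ → ℝ) : Prop :=
  χ u₁ = r₁ ∧ ∀ s ∈ Set.Icc 0 u₁, HasDerivAt χ (-(1/2) * (1 - Λ/3 * (χ s)^2)) s

/-- The value of the operator `F` at `(u₁, r₁)`, computed along the characteristic `χ`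
through `(u₁,r₁)`. -/
noncomputable def Fval (Λ : ℝ) (χ : ℝ → ℝ) (h₀ : ℝ → ℝ) (h : ℝ → ℝ → ℝ) (u₁ : ℝ) : ℝ :=
  h₀ (χ 0) * Real.exp (-(Λ/3) * ∫ s in (0:ℝ)..u₁, χ s)
    + (Λ/3) * ∫ v in (0:ℝ)..u₁,
        χ v * hbar h v (χ v) * Real.exp (-(Λ/3) * ∫ s in v..u₁, χ s)

/-- The spherical mean inherits any bound on the function being averaged. -/
theorem abs_hbar_le {h : ℝ → ℝ → ℝ} {u r y : ℝ} (hr : 0 ≤ r)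
    (hb : ∀ s, 0 ≤ s → |h u s| ≤ y) : |hbar h u r| ≤ y := by
  unfold hbar
  split_ifs with h0
  · exact hb 0 le_rfl
  · have hpos : 0 < r := lt_of_le_of_ne hr (Ne.symm h0)
    rw [abs_div, abs_of_pos hpos, div_le_iff₀ hpos]
    have := intervalIntegral.norm_integral_le_of_norm_le_const (a := 0) (b := r) (C := y)
      (f := fun s => h u s) (fun s hs => by
        rw [uIoc_of_le hr] at hs
        exact hb s hs.1.le)
    simpa [abs_of_pos hpos] using this

/-- The primitive `v ↦ ∫ₛ₌ᵥᵇ f` is continuous on `[a,b]` when `f` is. -/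
theorem continuousOn_integral_left {f : ℝ → ℝ} {a b : ℝ} (hab : a ≤ b)
    (hf : ContinuousOn f (Icc a b)) : ContinuousOn (fun v => ∫ s in v..b, f s) (Icc a b) := by
  rw [← uIcc_of_le hab] at hf ⊢
  exact intervalIntegral.continuousOn_primitive_interval_left
    (hf.integrableOn_compact isCompact_uIcc)

/-- The integrating factor `v ↦ exp (-c ∫ₛ₌ᵥᵇ f)` is a primitive of `c * f` times itself. -/
theorem integral_mul_exp_neg_integral {f : ℝ → ℝ} {a b : ℝ} (c : ℝ) (hab : a ≤ b)
    (hf : ContinuousOn f (Icc a b)) :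
    ∫ v in a..b, c * (f v * exp (-c * ∫ s in v..b, f s)) = 1 - exp (-c * ∫ s in a..b, f s) := by
  have hg := continuousOn_integral_left hab hf
  have hE : ContinuousOn (fun v => exp (-c * ∫ s in v..b, f s)) (Icc a b) :=
    (continuousOn_const.mul hg).rexp
  rw [intervalIntegral.integral_eq_sub_of_hasDerivAt_of_le hab hE (fun v hv => ?_)]
  · simp
  · exact (continuousOn_const.mul (hf.mul hE)).intervalIntegrable_of_Icc hab
  · have hfv : ContinuousAt f v := hf.continuousAt (Icc_mem_nhds hv.1 hv.2)
    have hint : IntervalIntegrable f MeasureTheory.volume v b :=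
      (hf.mono (Icc_subset_Icc_left hv.1.le)).intervalIntegrable_of_Icc hv.2.le
    have hd := intervalIntegral.integral_hasDerivAt_left hint
      ((hf.mono Ioo_subset_Icc_self).stronglyMeasurableAtFilter isOpen_Ioo v hv) hfv
    exact (hd.const_mul (-c)).exp.congr_deriv (by ring)

/-- If `|h₀| ≤ y₀` on `[0,∞)` and `|h| ≤ y₀` on `[0,∞)²`, then
`|F(h)(u₁,r₁)| ≤ y₀` for all `(u₁,r₁) ∈ [0,∞)²`. -/
theorem F_preserves_bound
    (Λ : ℝ) (hΛ : 0 < Λ)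
    (h₀ : ℝ → ℝ) (h₀cont : ContinuousOn h₀ (Set.Ici 0))
    (h : ℝ → ℝ → ℝ)
    (hcont : ContinuousOn (fun q : ℝ × ℝ => h q.1 q.2) (Set.Ici 0 ×ˢ Set.Ici 0))
    (y₀ : ℝ) (hy₀ : 0 ≤ y₀)
    (hb₀ : ∀ r, 0 ≤ r → |h₀ r| ≤ y₀)
    (hb : ∀ u r, 0 ≤ u → 0 ≤ r → |h u r| ≤ y₀)
    (u₁ r₁ : ℝ) (hu₁ : 0 ≤ u₁) (hr₁ : 0 ≤ r₁)
    (χ : ℝ → ℝ) (hχ : IsChar Λ u₁ r₁ χ)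
    (hχnn : ∀ s ∈ Set.Icc 0 u₁, 0 ≤ χ s) :
    |Fval Λ χ h₀ h u₁| ≤ y₀ := by
  obtain ⟨-, hder⟩ := hχ
  have hc : ContinuousOn χ (Icc 0 u₁) := fun s hs => (hder s hs).continuousAt.continuousWithinAt
  have hE : ContinuousOn (fun v => exp (-(Λ/3) * ∫ s in v..u₁, χ s)) (Icc 0 u₁) :=
    (continuousOn_const.mul (continuousOn_integral_left hu₁ hc)).rexp
  have hint := integral_mul_exp_neg_integral (Λ/3) hu₁ hc
  rw [intervalIntegral.integral_const_mul] at hint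
  have hsource : |∫ v in (0:ℝ)..u₁,
      χ v * hbar h v (χ v) * exp (-(Λ/3) * ∫ s in v..u₁, χ s)| ≤
      ∫ v in (0:ℝ)..u₁, y₀ * (χ v * exp (-(Λ/3) * ∫ s in v..u₁, χ s)) := by
    rw [← norm_eq_abs]
    refine intervalIntegral.norm_integral_le_of_norm_le hu₁
      (Filter.Eventually.of_forall fun v hv => ?_)
      (ContinuousOn.intervalIntegrable_of_Icc hu₁ (continuousOn_const.mul (hc.mul hE)))
    have hv' : v ∈ Icc 0 u₁ := Ioc_subset_Icc_self hv
    have hχv := hχnn v hv'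
    have hm := abs_hbar_le hχv fun s hs => hb v s hv'.1 hs
    rw [norm_eq_abs, abs_mul, abs_mul, abs_of_nonneg hχv, abs_exp]
    calc _ ≤ χ v * y₀ * exp (-(Λ/3) * ∫ s in v..u₁, χ s) := by gcongr
      _ = _ := by ring
  rw [intervalIntegral.integral_const_mul] at hsource
  have hinit := hb₀ (χ 0) (hχnn 0 ⟨le_rfl, hu₁⟩)
  unfold Fval
  calc _ ≤ _ := abs_add_le _ _
    _ ≤ y₀ * exp (-(Λ/3) * ∫ s in (0:ℝ)..u₁, χ s) +
        Λ/3 * (y₀ * ∫ v in (0:ℝ)..u₁, χ v * exp (-(Λ/3) * ∫ s in v..u₁, χ s)) := by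
      rw [abs_mul, abs_exp, abs_mul, abs_of_pos (by positivity : 0 < Λ/3)]
      gcongr
    _ = y₀ := by linear_combination y₀ * hint
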